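/- Fix real parameters a > 0 and b ∈ (0,1), and let E : ℝ → ℝ be given by E(s) = exp(−1/s) for s > 0 and E(s) = 0 for s ≤ 0. Consider the vector field H on ℝ³ (coordinates (x₂, r₂, ε)) given by x₂' = −x₂·(x₂ + b·r₂·(1 − 2E(ε))) + r₂·ε·(a + r₂·E(ε)²), r₂' = −r₂·(2 + ε)·(x₂ + b·r₂·(1 − 2E(ε))), ε' = ε²·(x₂ + b·r₂·(1 − 2E(ε))). Then for every x ≤ 0 the point (x, −x/b, 0) is an equilibrium of H, and the derivative of H at (x, −x/b, 0) has eigenvalues 0, 0, x (characteristic polynomial λ²(λ − x)); in particular the line 𝒩'₂ = {(x, −x/b, 0) : x ≤ 0} is a normally hyperbolic attracting line of equilibria for x < 0 and terminates in a non-hyperbolic point at the origin. -/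

import Mathlib

/-- The exponential `exp(−1/s)` extended by `0` to `s ≤ 0`. -/
noncomputable def expE (s : ℝ) : ℝ := if 0 < s then Real.exp (-1 / s) else 0

/-- The desingularized blown-up Le Corbeiller system in chart `𝒦₂` restricted to the
invariant set `Q'₂`, coordinates `(x₂, r₂, ε)`. -/
noncomputable def corbSphereK2Field (a b : ℝ) (p : ℝ × ℝ × ℝ) : ℝ × ℝ × ℝ :=
  (-p.1 * (p.1 + b * p.2.1 * (1 - 2 * expE p.2.2)) +
      p.2.1 * p.2.2 * (a + p.2.1 * expE p.2.2 ^ 2),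
   -p.2.1 * (2 + p.2.2) * (p.1 + b * p.2.1 * (1 - 2 * expE p.2.2)),
   p.2.2 ^ 2 * (p.1 + b * p.2.1 * (1 - 2 * expE p.2.2)))

theorem expE_eq_expNegInvGlue : expE = expNegInvGlue := by
  funext s
  unfold expE expNegInvGlue
  by_cases h : 0 < s
  · rw [if_pos h, if_neg (not_le.mpr h), neg_div, one_div]
  · rw [if_neg h, if_pos (not_lt.mp h)]

theorem expE_zero : expE 0 = 0 := by simp [expE]

/-- `expE` is differentiable at `0`, where it attains its minimum. -/
theorem hasDerivAt_expE_zero : HasDerivAt expE 0 0 := by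
  have hd : DifferentiableAt ℝ expE 0 := by
    rw [expE_eq_expNegInvGlue]
    exact (expNegInvGlue.contDiff (n := 1)).differentiable one_ne_zero 0
  have hmin : IsLocalMin expE 0 := Filter.Eventually.of_forall fun s => by
    rw [expE_zero, expE_eq_expNegInvGlue]
    exact expNegInvGlue.nonneg s
  simpa only [hmin.deriv_eq_zero] using hd.hasDerivAt

/-- The linearization of the vector field at the point `(x, r, 0)` of the line `x + b * r = 0`. -/
noncomputable def corbSphereK2Linearization (a b x r : ℝ) : ℝ × ℝ × ℝ →L[ℝ] ℝ × ℝ × ℝ :=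
  let X := ContinuousLinearMap.fst ℝ ℝ (ℝ × ℝ)
  let R := (ContinuousLinearMap.fst ℝ ℝ ℝ).comp (ContinuousLinearMap.snd ℝ ℝ (ℝ × ℝ))
  let Z := (ContinuousLinearMap.snd ℝ ℝ ℝ).comp (ContinuousLinearMap.snd ℝ ℝ (ℝ × ℝ))
  ((-x) • (X + b • R) + (r * a) • Z).prod (((-(r * 2)) • (X + b • R)).prod 0)

theorem hasFDerivAt_corbSphereK2Field {a b x r : ℝ} (h : x + b * r = 0) :
    HasFDerivAt (corbSphereK2Field a b) (corbSphereK2Linearization a b x r) (x, r, 0) := by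
  have hX : HasFDerivAt (𝕜 := ℝ) (fun p : ℝ × ℝ × ℝ => p.1) _ (x, r, 0) := hasFDerivAt_fst
  have hS : HasFDerivAt (𝕜 := ℝ) (fun p : ℝ × ℝ × ℝ => p.2) _ (x, r, 0) := hasFDerivAt_snd
  have hR := hS.fst
  have hZ := hS.snd
  have hE : HasFDerivAt (𝕜 := ℝ) (fun p : ℝ × ℝ × ℝ => expE p.2.2) _ (x, r, 0) :=
    HasDerivAt.comp_hasFDerivAt (h₂ := expE) (h₂' := 0) (x, r, 0) hasDerivAt_expE_zero hZ
  have hG := hX.add ((hR.const_mul b).mul ((hE.const_mul 2).const_sub 1))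
  have h1 := (hX.neg.mul hG).add ((hR.mul hZ).mul ((hR.mul (hE.pow 2)).const_add a))
  have h2 := (hR.neg.mul (hZ.const_add 2)).mul hG
  have h3 := (hZ.pow 2).mul hG
  refine (h1.prodMk (h2.prodMk h3)).congr_fderiv ?_
  ext <;> simp [corbSphereK2Linearization, expE_zero, h] <;> ring

/-- The standard coordinates on `ℝ × ℝ × ℝ`. -/
def realTripleEquivFun : (ℝ × ℝ × ℝ) ≃ₗ[ℝ] (Fin 3 → ℝ) where
  toFun p := ![p.1, p.2.1, p.2.2]
  invFun v := (v 0, v 1, v 2)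
  map_add' p q := by ext i; fin_cases i <;> rfl
  map_smul' c p := by ext i; fin_cases i <;> rfl
  left_inv _ := rfl
  right_inv v := by ext i; fin_cases i <;> rfl

theorem realTripleEquivFun_apply (p : ℝ × ℝ × ℝ) :
    realTripleEquivFun p = ![p.1, p.2.1, p.2.2] := rfl

theorem realTripleEquivFun_symm_apply (v : Fin 3 → ℝ) :
    realTripleEquivFun.symm v = (v 0, v 1, v 2) := rfl

/-- The standard basis of `ℝ × ℝ × ℝ`. -/
noncomputable def realTripleBasis : Module.Basis (Fin 3) ℝ (ℝ × ℝ × ℝ) :=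
  Module.Basis.ofEquivFun realTripleEquivFun

theorem toMatrix_corbSphereK2Linearization (a b x r : ℝ) :
    LinearMap.toMatrix realTripleBasis realTripleBasis
      (corbSphereK2Linearization a b x r).toLinearMap =
      !![-x, -x * b, r * a; -(r * 2), -(r * 2 * b), 0; 0, 0, 0] := by
  ext i j
  rw [LinearMap.toMatrix_apply]
  fin_cases i <;> fin_cases j <;>
    simp [realTripleBasis, realTripleEquivFun_apply, realTripleEquivFun_symm_apply,
      corbSphereK2Linearization]

theorem charpoly_corbSphereK2Linearization {a b x r : ℝ} (h : x + b * r = 0) :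
    (corbSphereK2Linearization a b x r).toLinearMap.charpoly =
      Polynomial.X ^ 2 * (Polynomial.X - Polynomial.C x) := by
  rw [← LinearMap.charpoly_toMatrix _ realTripleBasis, toMatrix_corbSphereK2Linearization]
  obtain rfl : x = -(b * r) := eq_neg_of_add_eq_zero_left h
  simp [Matrix.charpoly, Matrix.charmatrix, Matrix.det_fin_three, map_ofNat Polynomial.C 2]
  ring

/-- Every point `(x, −x/b, 0)` with `x ≤ 0` is an equilibrium whose linearization has
characteristic polynomial `λ²(λ − x)`, i.e. eigenvalues `0, 0, x`: the line
`𝒩'₂ = {(x, −x/b, 0) : x ≤ 0}` is normally hyperbolic attracting for `x < 0` and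
terminates in a non-hyperbolic point at the origin. -/
theorem corbSphereK2_line_N (a b : ℝ) (ha : 0 < a) (hb : b ∈ Set.Ioo (0 : ℝ) 1)
    (x : ℝ) (hx : x ≤ 0) :
    corbSphereK2Field a b (x, -x / b, 0) = 0 ∧
    LinearMap.charpoly
        ((fderiv ℝ (corbSphereK2Field a b) (x, -x / b, 0)).toLinearMap) =
      Polynomial.X ^ 2 * (Polynomial.X - Polynomial.C x) := by
  have h : x + b * (-x / b) = 0 := by
    rw [mul_div_cancel₀ _ hb.1.ne', add_neg_cancel]
  refine ⟨by simp [corbSphereK2Field, expE_zero, h], ?_⟩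
  rw [(hasFDerivAt_corbSphereK2Field h).fderiv]
  exact charpoly_corbSphereK2Linearization h
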